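/- arXiv:2510.10668 — 2 statements merged into one kernel-verified Lean document; each statement's English description precedes it below -/
import Mathlib

section
/- Suppose the tensorial k-r-order orthogonality condition holds, and let T be the trace of Π w on the bottom edge of K̂ = [-1,1]², i.e. for an affine function w(x,y) = c₀ + c₁ x + c₂ y, T(x) = w(a^x_s, -1) for x ∈ (α^x_s, α^x_{s+1}), s = 0,...,k. Then for every real polynomial g₄ of degree ≤ r and every affine w, ∫_{-1}^{1} g₄(x) (w(x,-1) - T(x)) dx = 0. -/
open Finset

/-- The `k`-`r`-order moment equations in one direction:
`Σ_{s=1}^{k} (a_s - a_{s-1}) α_s^{i+1} = (1-(-1)^i)/(i+2)` for all `0 ≤ i ≤ r`. -/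
def momentEqs (k r : ℕ) (a α : ℕ → ℝ) : Prop :=
  ∀ i ≤ r, ∑ s ∈ Finset.Icc 1 k, (a s - a (s - 1)) * (α s) ^ (i + 1)
    = (1 - (-1 : ℝ) ^ i) / ((i : ℝ) + 2)

theorem abel_aux (a b : ℕ → ℝ) (k : ℕ) :
    ∑ s ∈ Finset.range (k + 1), a s * (b (s + 1) - b s)
      = a k * b (k + 1) - a 0 * b 0 - ∑ s ∈ Finset.Icc 1 k, (a s - a (s - 1)) * b s := by
  induction k with
  | zero => simp; ring
  | succ n ih =>
    rw [Finset.sum_range_succ, ih, Finset.sum_Icc_succ_top (by omega)]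
    simp only [Nat.add_sub_cancel]
    ring

theorem piece_aux (g : Polynomial ℝ) (r : ℕ) (hg : g.natDegree ≤ r) (c e u v : ℝ) :
    ∫ x in u..v, g.eval x * (c * (x - e))
      = ∑ i ∈ Finset.range (r + 1), g.coeff i * c *
        ((v ^ (i + 2) - u ^ (i + 2)) / ((i : ℝ) + 2)
          - e * (v ^ (i + 1) - u ^ (i + 1)) / ((i : ℝ) + 1)) := by
  have h1 : ∀ x : ℝ, g.eval x * (c * (x - e)) =
      ∑ i ∈ Finset.range (r + 1), (g.coeff i * c) * (x ^ (i + 1) - e * x ^ i) := by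
    intro x
    rw [Polynomial.eval_eq_sum_range' (Nat.lt_succ_of_le hg), Finset.sum_mul]
    refine Finset.sum_congr rfl fun i _ => ?_
    ring
  simp_rw [h1]
  rw [intervalIntegral.integral_finsetSum
    (fun i _ => Continuous.intervalIntegrable (by fun_prop) _ _)]
  refine Finset.sum_congr rfl fun i _ => ?_
  rw [intervalIntegral.integral_const_mul, intervalIntegral.integral_sub
    (Continuous.intervalIntegrable (by fun_prop) _ _)
    (Continuous.intervalIntegrable (by fun_prop) _ _),
    intervalIntegral.integral_const_mul, integral_pow, integral_pow]
  push_cast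
  ring

/-- Under the tensorial `k`-`r`-order orthogonality condition, with `T` the trace of `Π w` on
the bottom edge of `K̂ = [-1,1]²` (so `T(x) = w(aˣ_s, -1)` for `x ∈ (αˣ_s, αˣ_{s+1})`), for
every polynomial `g₄` of degree `≤ r` and every affine `w(x,y) = c₀ + c₁ x + c₂ y` one has
`∫_{-1}^{1} g₄(x) (w(x,-1) - T(x)) dx = 0`. -/
theorem tensorial_orth_edge (k r : ℕ) (hk : 1 ≤ k) (ax ay αx αy : ℕ → ℝ)
    (hax0 : ax 0 = -1) (haxk : ax k = 1)
    (haxmono : ∀ s t : ℕ, s < t → t ≤ k → ax s < ax t)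
    (hxinter : ∀ s : ℕ, 1 ≤ s → s ≤ k → ax (s - 1) < αx s ∧ αx s < ax s)
    (hαx0 : αx 0 = -1) (hαxtop : αx (k + 1) = 1)
    (hay0 : ay 0 = -1) (hayk : ay k = 1)
    (haymono : ∀ s t : ℕ, s < t → t ≤ k → ay s < ay t)
    (hyinter : ∀ s : ℕ, 1 ≤ s → s ≤ k → ay (s - 1) < αy s ∧ αy s < ay s)
    (hαy0 : αy 0 = -1) (hαytop : αy (k + 1) = 1)
    (hmx : momentEqs k r ax αx) (hmy : momentEqs k r ay αy) :
    ∀ g₄ : Polynomial ℝ, g₄.natDegree ≤ r → ∀ c₀ c₁ c₂ : ℝ,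
      (∫ x in (-1 : ℝ)..1,
        g₄.eval x * ((c₀ + c₁ * x + c₂ * (-1))
          - ∑ s ∈ Finset.range (k + 1),
              if αx s < x ∧ x < αx (s + 1) then c₀ + c₁ * ax s + c₂ * (-1) else 0)) = 0 := by
  intro g hg c₀ c₁ c₂
  have hstep : ∀ s, s ≤ k → αx s < αx (s + 1) := by
    intro s hs
    rcases Nat.eq_zero_or_pos s with rfl | h0
    · have := (hxinter 1 le_rfl hk).1
      simp only [Nat.sub_self] at this
      rw [hαx0, ← hax0]; exact this
    · rcases Nat.lt_or_ge s k with h | h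
      · have h1 := (hxinter s h0 hs).2
        have h2 := (hxinter (s + 1) (by omega) h).1
        simp only [Nat.add_sub_cancel] at h2
        exact h1.trans h2
      · obtain rfl : s = k := le_antisymm hs h
        have h1 := (hxinter s h0 hs).2
        rw [hαxtop, ← haxk]; exact h1
  have hmono : ∀ s t, s ≤ t → t ≤ k + 1 → αx s ≤ αx t := by
    intro s t hst
    induction t, hst using Nat.le_induction with
    | base => intro _; exact le_rfl
    | succ n hn ih => intro h; exact (ih (by omega)).trans (hstep n (by omega)).le
  have hEq : ∀ s, s < k + 1 → Set.EqOn (fun x : ℝ => g.eval x * (c₁ * (x - ax s)))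
      (fun x : ℝ => g.eval x * ((c₀ + c₁ * x + c₂ * (-1))
          - ∑ s ∈ Finset.range (k + 1),
              if αx s < x ∧ x < αx (s + 1) then c₀ + c₁ * ax s + c₂ * (-1) else 0))
      (Set.uIoo (αx s) (αx (s + 1))) := by
    intro s hs x hx
    rw [Set.uIoo_of_lt (hstep s (by omega))] at hx
    simp only
    rw [Finset.sum_eq_single s, if_pos ⟨hx.1, hx.2⟩]
    · ring
    · intro j hj hjs
      rw [Finset.mem_range] at hj
      rw [if_neg]
      rintro ⟨h1, h2⟩
      rcases lt_or_gt_of_ne hjs with h | h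
      · have := hmono (j + 1) s h (by omega)
        linarith [hx.1]
      · have := hmono (s + 1) j h (by omega)
        linarith [hx.2]
    · intro h; exact absurd (Finset.mem_range.2 hs) h
  have hint : ∀ s, IntervalIntegrable (fun x : ℝ => g.eval x * (c₁ * (x - ax s)))
      MeasureTheory.volume (αx s) (αx (s + 1)) := fun s =>
    Continuous.intervalIntegrable (by fun_prop) _ _
  have hsum := intervalIntegral.sum_integral_adjacent_intervals
    (fun s hs => (hint s).congr_uIoo (hEq s hs))
  rw [hαx0, hαxtop] at hsum
  rw [← hsum]
  rw [Finset.sum_congr rfl fun s hs => (intervalIntegral.integral_congr_uIoo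
    (μ := MeasureTheory.volume) (hEq s (Finset.mem_range.1 hs))).symm]
  simp_rw [piece_aux g r hg]
  rw [Finset.sum_comm]
  refine Finset.sum_eq_zero fun i hi => ?_
  rw [← Finset.mul_sum, Finset.sum_sub_distrib, ← Finset.sum_div, ← Finset.sum_div,
    Finset.sum_range_sub (fun s => αx s ^ (i + 2)),
    abel_aux ax (fun s => αx s ^ (i + 1)), hmx i (by simpa [Nat.lt_succ_iff] using hi),
    hαx0, hαxtop, hax0, haxk]
  have h1 : (i : ℝ) + 1 ≠ 0 := by positivity
  have h2 : (i : ℝ) + 2 ≠ 0 := by positivity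
  simp only [one_pow, pow_succ]
  field_simp
  ring
end

section
/- Suppose the k-r-order moment equations hold with r = k (and k ≥ 2). Let c_2, ..., c_k, c_{k+2} be reals and set R(x) = Σ_{s=2}^{k} c_s M̂_s(x) + c_{k+2} M̂_{k+2}(x). If R'(α_m) = 0 for every m = 1, ..., k-1, then also R'(α_k) = 0. -/
open Finset

/-- The M-functions on `[-1,1]`: `M̂_0 = 1`, `M̂_1 = x`, and for `i ≥ 1`,
`M̂_{i+1}(x) = (1/(2^i i!)) dⁱ⁻¹/dxⁱ⁻¹ (x²-1)ⁱ`. -/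
noncomputable def Mhat : ℕ → ℝ → ℝ
  | 0 => fun _ => 1
  | 1 => fun x => x
  | (i + 2) => fun x =>
      (1 / ((2 : ℝ) ^ (i + 1) * (Nat.factorial (i + 1) : ℝ))) *
        iteratedDeriv i (fun y => (y ^ 2 - 1) ^ (i + 1)) x

open Polynomial in
theorem iterDeriv_poly (n : ℕ) (p : ℝ[X]) :
    iteratedDeriv n (fun x => p.eval x) = fun x => (derivative^[n] p).eval x := by
  induction n with
  | zero => simp
  | succ n ih =>
    rw [iteratedDeriv_succ, ih]
    funext x
    rw [Function.iterate_succ_apply', Polynomial.deriv]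

open Polynomial in
theorem Mhat_poly (i : ℕ) : ∃ p : ℝ[X], (∀ x, Mhat (i + 2) x = p.eval x) ∧
    p.natDegree ≤ i + 2 ∧ p.eval 1 = 0 ∧ p.eval (-1) = 0 := by
  have hd : (X ^ 2 - 1 : ℝ[X]) ∣ derivative^[i] ((X ^ 2 - 1 : ℝ[X]) ^ (i + 1)) := by
    have := Polynomial.pow_sub_dvd_iterate_derivative_of_pow_dvd i
      (dvd_refl ((X ^ 2 - 1 : ℝ[X]) ^ (i + 1)))
    simpa using this
  refine ⟨C (1 / ((2 : ℝ) ^ (i + 1) * (Nat.factorial (i + 1) : ℝ))) *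
    derivative^[i] ((X ^ 2 - 1) ^ (i + 1)), ?_, ?_, ?_, ?_⟩
  · intro x
    have h := congrFun (iterDeriv_poly i ((X ^ 2 - 1) ^ (i + 1))) x
    simp only [eval_pow, eval_sub, eval_X, eval_one] at h
    rw [eval_mul, eval_C, ← h]
    rfl
  · refine (natDegree_C_mul_le _ _).trans ?_
    refine (natDegree_iterate_derivative _ _).trans ?_
    have h1 : (X ^ 2 - 1 : ℝ[X]).natDegree ≤ 2 := by compute_degree
    have h2 := natDegree_pow_le_of_le (i + 1) h1
    omega
  · obtain ⟨q, hq⟩ := hd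
    rw [hq]; simp
  · obtain ⟨q, hq⟩ := hd
    rw [hq]; simp

open Polynomial in
theorem moment_poly (k : ℕ) (a α : ℕ → ℝ) (ha0 : a 0 = -1) (hak : a k = 1)
    (hm : momentEqs k k a α) (p : ℝ[X]) (hp : p.natDegree ≤ k + 2) :
    ∑ s ∈ Finset.Icc 1 k, (a s - a (s - 1)) * (derivative p).eval (α s)
      = p.eval 1 - p.eval (-1) := by
  have hw : ∑ s ∈ Finset.Icc 1 k, (a s - a (s - 1)) = 2 := by
    have : ∀ n, ∑ s ∈ Finset.Icc 1 n, (a s - a (s - 1)) = a n - a 0 := by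
      intro n
      induction n with
      | zero => simp
      | succ n ih => rw [Finset.sum_Icc_succ_top (by omega), ih]; simp
    rw [this, hak, ha0]; norm_num
  have key : ∀ j < k + 3, ∀ b : ℝ,
      ∑ s ∈ Finset.Icc 1 k, (a s - a (s - 1)) * (derivative (monomial j b)).eval (α s)
      = (monomial j b).eval 1 - (monomial j b).eval (-1) := by
    intro j hj b
    match j with
    | 0 => simp
    | 1 =>
      simp only [derivative_monomial, eval_monomial]
      simp [← Finset.sum_mul, hw]; ring
    | i + 2 =>
      have h := hm i (by omega)
      simp only [derivative_monomial, eval_monomial]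
      have h0 : ((i : ℝ) + 2) ≠ 0 := by positivity
      rw [eq_div_iff h0, Finset.sum_mul] at h
      calc _ = b * ∑ s ∈ Finset.Icc 1 k, (a s - a (s - 1)) * α s ^ (i + 1) * ((i : ℝ) + 2) := by
            rw [Finset.mul_sum]
            refine Finset.sum_congr rfl fun s _ => ?_
            push_cast
            ring
        _ = _ := by rw [h]; ring
  rw [p.as_sum_range' (k + 3) (by omega)]
  simp only [derivative_sum, eval_finsetSum, Finset.mul_sum]
  rw [Finset.sum_comm, ← Finset.sum_sub_distrib]
  exact Finset.sum_congr rfl fun j hj => key j (Finset.mem_range.mp hj) _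

/-- Under the `k`-`k`-order moment equations (`k ≥ 2`), if
`R = Σ_{s=2}^{k} c_s M̂_s + c_{k+2} M̂_{k+2}` satisfies `R'(α_m) = 0` for `m = 1, ..., k-1`,
then also `R'(α_k) = 0`. -/
theorem deriv_vanishes_at_last_dual_point_ultra (k : ℕ) (hk : 2 ≤ k) (a α : ℕ → ℝ)
    (ha0 : a 0 = -1) (hak : a k = 1)
    (hamono : ∀ s t : ℕ, s < t → t ≤ k → a s < a t)
    (hinter : ∀ s : ℕ, 1 ≤ s → s ≤ k → a (s - 1) < α s ∧ α s < a s)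
    (hm : momentEqs k k a α)
    (c : ℕ → ℝ) (ck2 : ℝ)
    (hzero : ∀ m : ℕ, 1 ≤ m → m ≤ k - 1 →
      deriv (fun x => (∑ s ∈ Finset.Icc 2 k, c s * Mhat s x) + ck2 * Mhat (k + 2) x) (α m) = 0) :
    deriv (fun x => (∑ s ∈ Finset.Icc 2 k, c s * Mhat s x) + ck2 * Mhat (k + 2) x) (α k) = 0 := by
  choose M hM hdeg h1 hn1 using Mhat_poly
  let P : Polynomial ℝ := ∑ s ∈ Finset.Icc 2 k, Polynomial.C (c s) * M (s - 2)
    + Polynomial.C ck2 * M k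
  have hP : (fun x => (∑ s ∈ Finset.Icc 2 k, c s * Mhat s x) + ck2 * Mhat (k + 2) x)
      = fun x => P.eval x := by
    funext x
    simp only [P, Polynomial.eval_add, Polynomial.eval_finsetSum, Polynomial.eval_mul,
      Polynomial.eval_C, hM]
    congr 1
    refine Finset.sum_congr rfl fun s hs => ?_
    have h2 := (Finset.mem_Icc.mp hs).1
    rw [← hM (s - 2) x, Nat.sub_add_cancel h2]
  rw [hP] at hzero ⊢
  simp only [Polynomial.deriv] at hzero ⊢
  have hPd : P.natDegree ≤ k + 2 := by
    refine Polynomial.natDegree_add_le_of_degree_le ?_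
      ((Polynomial.natDegree_C_mul_le _ _).trans (hdeg k))
    refine Polynomial.natDegree_sum_le_of_forall_le _ _ fun s hs => ?_
    have h2 := Finset.mem_Icc.mp hs
    have := (Polynomial.natDegree_C_mul_le (c s) (M (s - 2))).trans (hdeg (s - 2))
    omega
  have hmom := moment_poly k a α ha0 hak hm P hPd
  have e1 : P.eval 1 = 0 := by simp [P, Polynomial.eval_finsetSum, h1]
  have e2 : P.eval (-1) = 0 := by simp [P, Polynomial.eval_finsetSum, hn1]
  rw [e1, e2, Finset.sum_eq_single_of_mem k (Finset.mem_Icc.mpr ⟨by omega, le_rfl⟩)] at hmom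
  · have := hamono (k - 1) k (by omega) le_rfl
    rcases mul_eq_zero.mp (hmom.trans (sub_zero 0)) with h | h
    · linarith
    · exact h
  · intro s hs hne
    have h2 := Finset.mem_Icc.mp hs
    rw [hzero s h2.1 (by omega), mul_zero]
end
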